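/- There exist universal constants c > 0 and C > 0 such that for every nonempty finite set X, all distributions p, q on X with H²(p,q) > 0, every ε with 0 ≤ ε ≤ H²(p,q)/9, and every model A ∈ {Hub, TV, Sub}: c/H²(p,q) ≤ n*_A(p,q,ε) ≤ C/H²(p,q). -/

import Mathlib

open scoped Classical ENNReal
open Finset

noncomputable section

/-- A probability distribution on a finite set. -/
def IsDist {X : Type*} [Fintype X] (p : X → ℝ) : Prop :=
  (∀ x, 0 ≤ p x) ∧ ∑ x, p x = 1

/-- Total variation distance. -/
def dTV {X : Type*} [Fintype X] (p q : X → ℝ) : ℝ :=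
  (1 / 2) * ∑ x, |p x - q x|

/-- Squared Hellinger divergence (also for unnormalized nonnegative vectors). -/
def hellSq {X : Type*} [Fintype X] (p q : X → ℝ) : ℝ :=
  ∑ x, (Real.sqrt (p x) - Real.sqrt (q x)) ^ 2

/-- ε-Huber uncertainty set. -/
def PHub {X : Type*} [Fintype X] (p : X → ℝ) (ε : ℝ) : Set (X → ℝ) :=
  {p' | IsDist p' ∧ ∀ x, (1 - ε) * p x ≤ p' x}

/-- ε-TV uncertainty set. -/
def PTV {X : Type*} [Fintype X] (p : X → ℝ) (ε : ℝ) : Set (X → ℝ) :=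
  {p' | IsDist p' ∧ dTV p' p ≤ ε}

/-- ε-subtractive uncertainty set. -/
def PSub {X : Type*} [Fintype X] (p : X → ℝ) (ε : ℝ) : Set (X → ℝ) :=
  {p' | IsDist p' ∧ ∀ x, p' x ≤ (1 + ε) * p x}

/-- Sum of worst-case type-I and type-II errors of a randomized test `φ` on `n`
i.i.d. samples, for composite hypotheses `Pcal` vs `Qcal`. -/
def errSum {X : Type*} [Fintype X] (Pcal Qcal : Set (X → ℝ)) (n : ℕ)
    (φ : (Fin n → X) → ℝ) : ℝ :=
  (⨆ P : Pcal, ∑ x : Fin n → X, (∏ i, (P : X → ℝ) (x i)) * φ x) +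
  (⨆ Q : Qcal, ∑ x : Fin n → X, (∏ i, (Q : X → ℝ) (x i)) * (1 - φ x))

/-- Minimax `n`-sample error for testing `Pcal` against `Qcal`. -/
def eStar {X : Type*} [Fintype X] (Pcal Qcal : Set (X → ℝ)) (n : ℕ) : ℝ :=
  ⨅ φ : {φ : (Fin n → X) → ℝ // ∀ x, 0 ≤ φ x ∧ φ x ≤ 1}, errSum Pcal Qcal n φ.1

/-- Sample complexity: the least `n` with minimax error at most `1/10` (`⊤` if none). -/
def nStar {X : Type*} [Fintype X] (Pcal Qcal : Set (X → ℝ)) : ℝ≥0∞ :=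
  sInf {N : ℝ≥0∞ | ∃ n : ℕ, N = (n : ℝ≥0∞) ∧ eStar Pcal Qcal n ≤ 1 / 10}

section HellingerStatistic

variable {X : Type*}

/-- The bounded statistic `(√q - √p) / (√q + √p)`, equal to `0` where both `p` and `q` vanish. -/
def hellStat (p q : X → ℝ) (x : X) : ℝ :=
  (√(q x) - √(p x)) / (√(q x) + √(p x))

lemma hellStat_swap (p q : X → ℝ) (x : X) : hellStat q p x = -hellStat p q x := by
  unfold hellStat
  rw [← neg_div, neg_sub, add_comm]

lemma hellStat_mul (p q : X → ℝ) (x : X) :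
    hellStat p q x * (√(q x) + √(p x)) = √(q x) - √(p x) := by
  rcases eq_or_ne (√(q x) + √(p x)) 0 with h | h
  · have hp := Real.sqrt_nonneg (p x)
    have hq := Real.sqrt_nonneg (q x)
    rw [h, mul_zero]
    linarith
  · exact div_mul_cancel₀ _ h

lemma abs_hellStat_le_one (p q : X → ℝ) (x : X) : |hellStat p q x| ≤ 1 := by
  have hp := Real.sqrt_nonneg (p x)
  have hq := Real.sqrt_nonneg (q x)
  rw [hellStat, abs_div, abs_of_nonneg (add_nonneg hq hp)]
  exact div_le_one_of_le₀ (abs_le.2 ⟨by linarith, by linarith⟩) (add_nonneg hq hp)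

lemma mul_hellStat_le {p q : X → ℝ} {x : X} (hp : 0 ≤ p x) (hq : 0 ≤ q x) :
    p x * hellStat p q x ≤ -(√(p x) - √(q x)) ^ 2 / 4 + (q x - p x) / 4 := by
  have h := hellStat_mul p q x
  obtain ⟨-, h1⟩ := abs_le.1 (abs_hellStat_le_one p q x)
  generalize hellStat p q x = a at h h1 ⊢
  have hp2 := Real.sq_sqrt hp
  have hq2 := Real.sq_sqrt hq
  generalize √(p x) = s at h hp2 ⊢
  generalize √(q x) = t at h hq2 ⊢
  rw [← hp2, ← hq2]
  obtain ⟨w, rfl⟩ : ∃ w, s = w - t := ⟨s + t, by ring⟩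
  have ht : t = w * (1 + a) / 2 := by linarith
  subst ht
  nlinarith [mul_nonneg (sub_nonneg.2 h1) (sq_nonneg (a * w))]

lemma mul_hellStat_sq_le {p q : X → ℝ} {x : X} (hp : 0 ≤ p x) :
    p x * hellStat p q x ^ 2 ≤ (√(p x) - √(q x)) ^ 2 := by
  have h := hellStat_mul p q x
  have hs := Real.sqrt_nonneg (p x)
  have ht := Real.sqrt_nonneg (q x)
  calc p x * hellStat p q x ^ 2 = √(p x) ^ 2 * hellStat p q x ^ 2 := by rw [Real.sq_sqrt hp]
    _ ≤ (√(q x) + √(p x)) ^ 2 * hellStat p q x ^ 2 := by gcongr; linarith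
    _ = (√(p x) - √(q x)) ^ 2 := by rw [← mul_pow, mul_comm, h]; ring

lemma exp_le_one_add_add_sq {x : ℝ} (hx : |x| ≤ 1) : Real.exp x ≤ 1 + x + x ^ 2 := by
  have := (abs_le.1 (Real.abs_exp_sub_one_sub_id_le hx)).2
  linarith

end HellingerStatistic

section Testing

variable {X : Type*} [Fintype X]

lemma hellSq_comm (p q : X → ℝ) : hellSq p q = hellSq q p :=
  sum_congr rfl fun _ _ => by ring

lemma sum_sqrt_mul_sqrt {p q : X → ℝ} (hp : IsDist p) (hq : IsDist q) :
    ∑ x, √(p x) * √(q x) = 1 - hellSq p q / 2 := by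
  have h : hellSq p q = ∑ x, (p x + q x - 2 * (√(p x) * √(q x))) :=
    sum_congr rfl fun x _ => by
      linear_combination Real.sq_sqrt (hp.1 x) + Real.sq_sqrt (hq.1 x)
  rw [sum_sub_distrib, sum_add_distrib, hp.2, hq.2, ← mul_sum] at h
  linarith

lemma hellSq_le_two {p q : X → ℝ} (hp : IsDist p) (hq : IsDist q) : hellSq p q ≤ 2 := by
  have h : 0 ≤ ∑ x, √(p x) * √(q x) := sum_nonneg fun _ _ => by positivity
  rw [sum_sqrt_mul_sqrt hp hq] at h
  linarith

lemma sum_mul_hellStat_le {p q r : X → ℝ} {ε : ℝ} (hp : IsDist p) (hq : IsDist q)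
    (hr : dTV r p ≤ ε) : ∑ x, r x * hellStat p q x ≤ -hellSq p q / 4 + 2 * ε := by
  calc ∑ x, r x * hellStat p q x
      ≤ ∑ x, (-(√(p x) - √(q x)) ^ 2 / 4 + (q x - p x) / 4 + |r x - p x|) := by
        refine sum_le_sum fun x _ => ?_
        have h1 := mul_hellStat_le (hp.1 x) (hq.1 x)
        have h2 : (r x - p x) * hellStat p q x ≤ |r x - p x| := by
          refine (le_abs_self _).trans ?_
          rw [abs_mul]
          exact mul_le_of_le_one_right (abs_nonneg _) (abs_hellStat_le_one p q x)
        linarith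
    _ = -hellSq p q / 4 + 2 * dTV r p := by
        simp only [sum_add_distrib, ← sum_div, sum_sub_distrib, sum_neg_distrib, hp.2, hq.2,
          hellSq, dTV]
        ring
    _ ≤ _ := by linarith

lemma sum_mul_hellStat_sq_le {p q r : X → ℝ} {ε : ℝ} (hp : IsDist p) (hr : dTV r p ≤ ε) :
    ∑ x, r x * hellStat p q x ^ 2 ≤ hellSq p q + 2 * ε := by
  calc ∑ x, r x * hellStat p q x ^ 2
      ≤ ∑ x, ((√(p x) - √(q x)) ^ 2 + |r x - p x|) := by
        refine sum_le_sum fun x _ => ?_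
        have h1 := mul_hellStat_sq_le (q := q) (hp.1 x)
        have h2 : (r x - p x) * hellStat p q x ^ 2 ≤ |r x - p x| := by
          refine (mul_le_mul_of_nonneg_right (le_abs_self _) (sq_nonneg _)).trans ?_
          exact mul_le_of_le_one_right (abs_nonneg _)
            ((sq_le_one_iff_abs_le_one _).2 (abs_hellStat_le_one p q x))
        linarith
    _ = hellSq p q + 2 * dTV r p := by
        simp only [sum_add_distrib, hellSq, dTV]
        ring
    _ ≤ _ := by linarith

lemma sum_mul_exp_hellStat_le {p q r : X → ℝ} {ε : ℝ} (hp : IsDist p) (hq : IsDist q)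
    (hr : IsDist r) (hrp : dTV r p ≤ ε) (hε : ε ≤ hellSq p q / 9) :
    ∑ x, r x * Real.exp (hellStat p q x / 144) ≤ 1 - hellSq p q / 10368 := by
  have h1 := sum_mul_hellStat_le hp hq hrp
  have h2 := sum_mul_hellStat_sq_le (q := q) hp hrp
  have hH : 0 ≤ hellSq p q := sum_nonneg fun _ _ => sq_nonneg _
  calc ∑ x, r x * Real.exp (hellStat p q x / 144)
      ≤ ∑ x, (r x + r x * hellStat p q x / 144 + r x * hellStat p q x ^ 2 / 144 ^ 2) := by
        refine sum_le_sum fun x _ => ?_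
        have h : |hellStat p q x / 144| ≤ 1 := by
          rw [abs_div, abs_of_pos (by norm_num : (0 : ℝ) < 144)]
          linarith [abs_hellStat_le_one p q x]
        exact (mul_le_mul_of_nonneg_left (exp_le_one_add_add_sq h) (hr.1 x)).trans_eq (by ring)
    _ = 1 + (∑ x, r x * hellStat p q x) / 144 + (∑ x, r x * hellStat p q x ^ 2) / 144 ^ 2 := by
        simp only [sum_add_distrib, ← sum_div, hr.2]
    _ ≤ _ := by linarith

lemma sum_prod_eq_pow (f : X → ℝ) (n : ℕ) :
    ∑ x : Fin n → X, ∏ i, f (x i) = (∑ x, f x) ^ n :=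
  (Fintype.sum_pow f n).symm

lemma sum_prod_eq_one {p : X → ℝ} (hp : IsDist p) (n : ℕ) :
    ∑ x : Fin n → X, ∏ i, p (x i) = 1 := by
  rw [sum_prod_eq_pow, hp.2, one_pow]

lemma errSum_nonneg {P Q : Set (X → ℝ)} (hP : ∀ r ∈ P, IsDist r) (hQ : ∀ r ∈ Q, IsDist r)
    {n : ℕ} {φ : (Fin n → X) → ℝ} (hφ : ∀ x, 0 ≤ φ x ∧ φ x ≤ 1) : 0 ≤ errSum P Q n φ :=
  add_nonneg
    (Real.iSup_nonneg fun r => sum_nonneg fun x _ =>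
      mul_nonneg (prod_nonneg fun _ _ => (hP r r.2).1 _) (hφ x).1)
    (Real.iSup_nonneg fun r => sum_nonneg fun x _ =>
      mul_nonneg (prod_nonneg fun _ _ => (hQ r r.2).1 _) (sub_nonneg.2 (hφ x).2))

lemma eStar_le {P Q : Set (X → ℝ)} (hP : ∀ r ∈ P, IsDist r) (hQ : ∀ r ∈ Q, IsDist r)
    {n : ℕ} {φ : (Fin n → X) → ℝ} (hφ : ∀ x, 0 ≤ φ x ∧ φ x ≤ 1) :
    eStar P Q n ≤ errSum P Q n φ :=
  ciInf_le (f := fun φ : {φ : (Fin n → X) → ℝ // ∀ x, 0 ≤ φ x ∧ φ x ≤ 1} => errSum P Q n φ.1)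
    ⟨0, Set.forall_mem_range.2 fun ψ => errSum_nonneg hP hQ ψ.2⟩ ⟨φ, hφ⟩

lemma sum_prod_mul_le_iSup {P : Set (X → ℝ)} (hP : ∀ r ∈ P, IsDist r) {p : X → ℝ} (hp : p ∈ P)
    {n : ℕ} {φ : (Fin n → X) → ℝ} (hφ : ∀ x, φ x ≤ 1) :
    ∑ x : Fin n → X, (∏ i, p (x i)) * φ x ≤
      ⨆ r : P, ∑ x : Fin n → X, (∏ i, (r : X → ℝ) (x i)) * φ x := by
  refine le_ciSup (f := fun r : P => ∑ x : Fin n → X, (∏ i, (r : X → ℝ) (x i)) * φ x)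
    ⟨1, Set.forall_mem_range.2 fun r => ?_⟩ ⟨p, hp⟩
  rw [← sum_prod_eq_one (hP r r.2) n]
  exact sum_le_sum fun x _ =>
    mul_le_of_le_one_right (prod_nonneg fun i _ => (hP r r.2).1 _) (hφ x)

/-- Le Cam's two-point bound, in terms of the Hellinger affinity. -/
lemma affinity_pow_le_errSum {P Q : Set (X → ℝ)} (hP : ∀ r ∈ P, IsDist r)
    (hQ : ∀ r ∈ Q, IsDist r) {p q : X → ℝ} (hp : p ∈ P) (hq : q ∈ Q)
    {n : ℕ} {φ : (Fin n → X) → ℝ} (hφ : ∀ x, 0 ≤ φ x ∧ φ x ≤ 1) :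
    (1 - hellSq p q / 2) ^ n ≤ 15 / 8 * errSum P Q n φ + 1 / 4 := by
  have key : ∀ x : Fin n → X, ∏ i, √(p (x i)) * √(q (x i)) ≤
      15 / 8 * ((∏ i, p (x i)) * φ x + (∏ i, q (x i)) * (1 - φ x)) +
        (∏ i, p (x i) + ∏ i, q (x i)) / 8 := fun x => by
    have hS : (∏ i, √(p (x i))) ^ 2 = ∏ i, p (x i) := by
      rw [← prod_pow]
      exact prod_congr rfl fun _ _ => Real.sq_sqrt ((hP p hp).1 _)
    have hT : (∏ i, √(q (x i))) ^ 2 = ∏ i, q (x i) := by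
      rw [← prod_pow]
      exact prod_congr rfl fun _ _ => Real.sq_sqrt ((hQ q hq).1 _)
    rw [prod_mul_distrib, ← hS, ← hT]
    generalize ∏ i, √(p (x i)) = S
    generalize ∏ i, √(q (x i)) = T
    nlinarith [mul_nonneg (hφ x).1 (sq_nonneg (4 * S - T)),
      mul_nonneg (sub_nonneg.2 (hφ x).2) (sq_nonneg (S - 4 * T))]
  have hsum := sum_le_sum fun x (_ : x ∈ univ) => key x
  rw [sum_prod_eq_pow fun x => √(p x) * √(q x), sum_sqrt_mul_sqrt (hP p hp) (hQ q hq),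
    sum_add_distrib, ← mul_sum, ← sum_div, sum_add_distrib, sum_add_distrib,
    sum_prod_eq_one (hP p hp), sum_prod_eq_one (hQ q hq)] at hsum
  have h1 := sum_prod_mul_le_iSup hP hp fun x => (hφ x).2
  have h2 := sum_prod_mul_le_iSup (n := n) (φ := fun x => 1 - φ x) hQ hq
    fun x => sub_le_self 1 (hφ x).1
  rw [errSum]
  linarith

lemma one_le_mul_hellSq_of_eStar_le {P Q : Set (X → ℝ)} (hP : ∀ r ∈ P, IsDist r)
    (hQ : ∀ r ∈ Q, IsDist r) {p q : X → ℝ} (hp : p ∈ P) (hq : q ∈ Q) {n : ℕ}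
    (h : eStar P Q n ≤ 1 / 10) : 1 ≤ n * hellSq p q := by
  have hlow : ((1 - hellSq p q / 2) ^ n - 1 / 4) * (8 / 15) ≤ eStar P Q n := by
    have : Nonempty {φ : (Fin n → X) → ℝ // ∀ x, 0 ≤ φ x ∧ φ x ≤ 1} :=
      ⟨⟨0, fun _ => ⟨le_rfl, zero_le_one⟩⟩⟩
    refine le_ciInf fun φ => ?_
    linarith [affinity_pow_le_errSum hP hQ hp hq φ.2]
  have hbern := one_add_mul_le_pow (a := -(hellSq p q / 2))
    (by linarith [hellSq_le_two (hP p hp) (hQ q hq)]) n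
  rw [← sub_eq_add_neg] at hbern
  linarith

/-- The exponential Markov inequality for `n` i.i.d. samples. -/
lemma sum_prod_mul_le_pow {r f : X → ℝ} (hr : IsDist r) {n : ℕ} {φ : (Fin n → X) → ℝ}
    (hφ : ∀ x, φ x ≤ Real.exp (∑ i, f (x i))) :
    ∑ x : Fin n → X, (∏ i, r (x i)) * φ x ≤ (∑ x, r x * Real.exp (f x)) ^ n := by
  rw [← sum_prod_eq_pow]
  refine sum_le_sum fun x _ => ?_
  rw [prod_mul_distrib, ← Real.exp_sum]
  exact mul_le_mul_of_nonneg_left (hφ x) (prod_nonneg fun i _ => hr.1 _)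

lemma sum_mul_exp_hellStat_pow_le {p q r : X → ℝ} {ε : ℝ} (hp : IsDist p) (hq : IsDist q)
    (hr : r ∈ PTV p ε) (hε : ε ≤ hellSq p q / 9) {n : ℕ} (hn : 41472 ≤ n * hellSq p q) :
    (∑ x, r x * Real.exp (hellStat p q x / 144)) ^ n ≤ 1 / 20 := by
  have h1 := sum_mul_exp_hellStat_le hp hq hr.1 hr.2 hε
  have h2 : 1 - hellSq p q / 10368 ≤ Real.exp (-(hellSq p q / 10368)) := by
    linarith [Real.add_one_le_exp (-(hellSq p q / 10368))]
  have h0 : 0 ≤ ∑ x, r x * Real.exp (hellStat p q x / 144) :=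
    sum_nonneg fun x _ => mul_nonneg (hr.1.1 x) (Real.exp_nonneg _)
  calc (∑ x, r x * Real.exp (hellStat p q x / 144)) ^ n
      ≤ Real.exp (-(hellSq p q / 10368)) ^ n := pow_le_pow_left₀ h0 (h1.trans h2) n
    _ = Real.exp (n * -(hellSq p q / 10368)) := (Real.exp_nat_mul _ n).symm
    _ ≤ Real.exp (-(4 : ℕ)) := Real.exp_le_exp.2 (by push_cast; linarith)
    _ = (Real.exp 1 ^ 4)⁻¹ := by rw [Real.exp_neg, ← Real.exp_one_pow]
    _ ≤ ((2.7 : ℝ) ^ 4)⁻¹ := by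
        have := Real.exp_one_gt_d9
        gcongr
        linarith
    _ ≤ 1 / 20 := by norm_num

lemma eStar_le_of_subset_PTV {P Q : Set (X → ℝ)} {p q : X → ℝ} {ε : ℝ} (hp : IsDist p)
    (hq : IsDist q) (hP : P ⊆ PTV p ε) (hQ : Q ⊆ PTV q ε) (hpP : p ∈ P) (hqQ : q ∈ Q)
    (hε : ε ≤ hellSq p q / 9) {n : ℕ} (hn : 41472 ≤ n * hellSq p q) :
    eStar P Q n ≤ 1 / 10 := by
  let φ : (Fin n → X) → ℝ := fun x => if 0 ≤ ∑ i, hellStat p q (x i) / 144 then 1 else 0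
  have hφ : ∀ x, 0 ≤ φ x ∧ φ x ≤ 1 := fun x => by
    by_cases h : 0 ≤ ∑ i, hellStat p q (x i) / 144 <;> simp [φ, h]
  have hφ1 : ∀ x, φ x ≤ Real.exp (∑ i, hellStat p q (x i) / 144) := fun x => by
    by_cases h : 0 ≤ ∑ i, hellStat p q (x i) / 144
    · simpa only [φ, if_pos h] using Real.one_le_exp h
    · simpa only [φ, if_neg h] using Real.exp_nonneg _
  have hφ2 : ∀ x, 1 - φ x ≤ Real.exp (∑ i, hellStat q p (x i) / 144) := fun x => by
    simp only [hellStat_swap p q, neg_div, sum_neg_distrib]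
    by_cases h : 0 ≤ ∑ i, hellStat p q (x i) / 144
    · simpa only [φ, if_pos h, sub_self] using Real.exp_nonneg _
    · simpa only [φ, if_neg h, sub_zero] using Real.one_le_exp (neg_nonneg.2 (not_le.1 h).le)
  have : Nonempty P := ⟨⟨p, hpP⟩⟩
  have : Nonempty Q := ⟨⟨q, hqQ⟩⟩
  refine (eStar_le (fun r hr => (hP hr).1) (fun r hr => (hQ hr).1) hφ).trans ?_
  have h1 : (⨆ r : P, ∑ x : Fin n → X, (∏ i, (r : X → ℝ) (x i)) * φ x) ≤ 1 / 20 :=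
    ciSup_le fun r => (sum_prod_mul_le_pow (hP r.2).1 hφ1).trans
      (sum_mul_exp_hellStat_pow_le hp hq (hP r.2) hε hn)
  rw [hellSq_comm] at hε hn
  have h2 : (⨆ r : Q, ∑ x : Fin n → X, (∏ i, (r : X → ℝ) (x i)) * (1 - φ x)) ≤ 1 / 20 :=
    ciSup_le fun r => (sum_prod_mul_le_pow (hQ r.2).1 hφ2).trans
      (sum_mul_exp_hellStat_pow_le hq hp (hQ r.2) hε hn)
  rw [errSum]
  linarith

theorem nStar_bounds_of_subset_PTV {P Q : Set (X → ℝ)} {p q : X → ℝ} {ε : ℝ} (hp : IsDist p)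
    (hq : IsDist q) (hpq : 0 < hellSq p q) (hP : P ⊆ PTV p ε) (hQ : Q ⊆ PTV q ε) (hpP : p ∈ P)
    (hqQ : q ∈ Q) (hε : ε ≤ hellSq p q / 9) :
    ENNReal.ofReal (1 / hellSq p q) ≤ nStar P Q ∧
      nStar P Q ≤ ENNReal.ofReal (41474 / hellSq p q) := by
  constructor
  · refine le_sInf ?_
    rintro _ ⟨n, rfl, hn⟩
    rw [← ENNReal.ofReal_natCast]
    refine ENNReal.ofReal_le_ofReal ((div_le_iff₀ hpq).2 ?_)
    exact one_le_mul_hellSq_of_eStar_le (fun r hr => (hP hr).1) (fun r hr => (hQ hr).1) hpP hqQ hn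
  · refine sInf_le_of_le ⟨⌈41472 / hellSq p q⌉₊, rfl, ?_⟩ ?_
    · exact eStar_le_of_subset_PTV hp hq hP hQ hpP hqQ hε ((div_le_iff₀ hpq).1 (Nat.le_ceil _))
    · rw [← ENNReal.ofReal_natCast]
      refine ENNReal.ofReal_le_ofReal ?_
      have h1 := Nat.ceil_lt_add_one (div_nonneg (by norm_num : (0 : ℝ) ≤ 41472) hpq.le)
      have h2 : 1 ≤ 2 / hellSq p q := (one_le_div hpq).2 (hellSq_le_two hp hq)
      have h3 : 41474 / hellSq p q = 41472 / hellSq p q + 2 / hellSq p q := by ring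
      linarith

lemma dTV_comm (p q : X → ℝ) : dTV p q = dTV q p := by
  simp only [dTV, abs_sub_comm]

lemma dTV_le_of_forall_sub_le {p r : X → ℝ} {ε : ℝ} (hp : IsDist p) (hr : IsDist r) (hε : 0 ≤ ε)
    {s : X → ℝ} (hs : IsDist s) (h : ∀ x, r x - p x ≤ ε * s x) : dTV r p ≤ ε := by
  have hle : ∑ x, |r x - p x| ≤ ∑ x, (2 * (ε * s x) - (r x - p x)) :=
    sum_le_sum fun x _ => abs_le'.2
      ⟨by linarith [h x], by linarith [h x, mul_nonneg hε (hs.1 x)]⟩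
  rw [sum_sub_distrib, sum_sub_distrib, ← mul_sum, ← mul_sum, hp.2, hr.2, hs.2] at hle
  rw [dTV]
  linarith

lemma PHub_subset_PTV {p : X → ℝ} {ε : ℝ} (hp : IsDist p) (hε : 0 ≤ ε) :
    PHub p ε ⊆ PTV p ε := fun r hr =>
  ⟨hr.1, (dTV_comm r p).trans_le <|
    dTV_le_of_forall_sub_le hr.1 hp hε hp fun x => by linarith [hr.2 x]⟩

lemma PSub_subset_PTV {p : X → ℝ} {ε : ℝ} (hp : IsDist p) (hε : 0 ≤ ε) :
    PSub p ε ⊆ PTV p ε := fun r hr =>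
  ⟨hr.1, dTV_le_of_forall_sub_le hp hr.1 hε hp fun x => by linarith [hr.2 x]⟩

lemma self_mem_PHub {p : X → ℝ} {ε : ℝ} (hp : IsDist p) (hε : 0 ≤ ε) : p ∈ PHub p ε :=
  ⟨hp, fun x => by linarith [mul_nonneg hε (hp.1 x)]⟩

lemma self_mem_PSub {p : X → ℝ} {ε : ℝ} (hp : IsDist p) (hε : 0 ≤ ε) : p ∈ PSub p ε :=
  ⟨hp, fun x => by linarith [mul_nonneg hε (hp.1 x)]⟩

end Testing

/-- For contamination level at most `H²(p,q)/9`, the robust sample complexity in each of the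
Huber, TV and subtractive models is of order `1/H²(p,q)`. -/
theorem small_eps_sample_complexity :
    ∃ c C : ℝ, 0 < c ∧ 0 < C ∧
      ∀ (X : Type) [Fintype X] [Nonempty X] (p q : X → ℝ),
        IsDist p → IsDist q → 0 < hellSq p q →
        ∀ ε : ℝ, 0 ≤ ε → ε ≤ hellSq p q / 9 →
          (ENNReal.ofReal (c / hellSq p q) ≤ nStar (PHub p ε) (PHub q ε) ∧
            nStar (PHub p ε) (PHub q ε) ≤ ENNReal.ofReal (C / hellSq p q)) ∧
          (ENNReal.ofReal (c / hellSq p q) ≤ nStar (PTV p ε) (PTV q ε) ∧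
            nStar (PTV p ε) (PTV q ε) ≤ ENNReal.ofReal (C / hellSq p q)) ∧
          (ENNReal.ofReal (c / hellSq p q) ≤ nStar (PSub p ε) (PSub q ε) ∧
            nStar (PSub p ε) (PSub q ε) ≤ ENNReal.ofReal (C / hellSq p q)) := by
  refine ⟨1, 41474, one_pos, by norm_num, fun X _ _ p q hp hq hpq ε hε hεH => ⟨?_, ?_, ?_⟩⟩
  · exact nStar_bounds_of_subset_PTV hp hq hpq (PHub_subset_PTV hp hε) (PHub_subset_PTV hq hε)
      (self_mem_PHub hp hε) (self_mem_PHub hq hε) hεH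
  · exact nStar_bounds_of_subset_PTV hp hq hpq subset_rfl subset_rfl
      (PHub_subset_PTV hp hε (self_mem_PHub hp hε))
      (PHub_subset_PTV hq hε (self_mem_PHub hq hε)) hεH
  · exact nStar_bounds_of_subset_PTV hp hq hpq (PSub_subset_PTV hp hε) (PSub_subset_PTV hq hε)
      (self_mem_PSub hp hε) (self_mem_PSub hq hε) hεH

end
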